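/- arXiv:1806.11148 — 2 statements merged into one kernel-verified Lean document; each statement's English description precedes it below -/
import Mathlib

section
/- Let S₁ and S₂ be numerical semigroups, let d₁ ∈ S₂ and d₂ ∈ S₁ be positive integers with gcd(d₁, d₂) = 1, and let S = d₁S₁ + d₂S₂. Suppose that for every n ∈ S, writing n = d₁n′ + d₂n″ with n′ ∈ Ap(S₁; d₂) and n″ ∈ S₂, one has m_S(n) = m_{S₁}(n′) + m_{S₂}(n″) (an m-harmonic gluing). Then in ℤ[[t]]: Σ_{n ∈ S} m_S(n) t^n = ( Σ_{n ∈ Ap(S₁;d₂)} m_{S₁}(n) t^{d₁ n} ) · ( Σ_{n ∈ S₂} t^{d₂ n} ) + ( Σ_{n ∈ Ap(S₁;d₂)} t^{d₁ n} ) · ( Σ_{n ∈ S₂} m_{S₂}(n) t^{d₂ n} ). -/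
open scoped Classical

/-- The additive submonoid of `ℕ` generated by `g 0, …, g (k-1)`. -/
def SemOf (k : ℕ) (g : Fin k → ℕ) : Set ℕ :=
  {m | ∃ a : Fin k → ℕ, m = ∑ i, a i * g i}

/-- The set of factorization lengths of `m` over the generators `g 0, …, g (k-1)`. -/
def LenOf (k : ℕ) (g : Fin k → ℕ) (m : ℕ) : Set ℕ :=
  {l | ∃ a : Fin k → ℕ, (∑ i, a i * g i) = m ∧ (∑ i, a i) = l}

/-- The set of factorization lengths of `m` over the combined generators
`d₁·g₁ i` and `d₂·g₂ j` of the gluing `S = d₁S₁ + d₂S₂`. -/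
def LenGlue (k₁ k₂ : ℕ) (g₁ : Fin k₁ → ℕ) (g₂ : Fin k₂ → ℕ) (d₁ d₂ : ℕ) (m : ℕ) : Set ℕ :=
  {l | ∃ a : Fin k₁ → ℕ, ∃ b : Fin k₂ → ℕ,
    (∑ i, a i * (d₁ * g₁ i)) + (∑ j, b j * (d₂ * g₂ j)) = m ∧
    (∑ i, a i) + (∑ j, b j) = l}

theorem SemOf.add_mem {k : ℕ} {g : Fin k → ℕ} {x y : ℕ} (hx : x ∈ SemOf k g)
    (hy : y ∈ SemOf k g) : x + y ∈ SemOf k g := by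
  obtain ⟨a, rfl⟩ := hx
  obtain ⟨b, rfl⟩ := hy
  exact ⟨a + b, by simp [add_mul, Finset.sum_add_distrib]⟩

theorem SemOf.add_mul_mem {k : ℕ} {g : Fin k → ℕ} {x d : ℕ} (hx : x ∈ SemOf k g)
    (hd : d ∈ SemOf k g) (n : ℕ) : x + n * d ∈ SemOf k g := by
  induction n with
  | zero => simpa using hx
  | succ n ih =>
    rw [add_one_mul, ← add_assoc]
    exact SemOf.add_mem ih hd

/-- Every element of a gluing is of the form `d₁ * x + d₂ * y` with `x` in the Apéry set. -/
theorem exists_apery_decomposition {k₁ k₂ : ℕ} {g₁ : Fin k₁ → ℕ} {g₂ : Fin k₂ → ℕ}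
    {d₁ d₂ : ℕ} (hd₂pos : 0 < d₂) (hd₁ : d₁ ∈ SemOf k₂ g₂) (x : ℕ) :
    x ∈ SemOf k₁ g₁ → ∀ y ∈ SemOf k₂ g₂,
      ∃ x' ∈ {x ∈ SemOf k₁ g₁ | ¬ ∃ y ∈ SemOf k₁ g₁, x = y + d₂}, ∃ y' ∈ SemOf k₂ g₂,
        d₁ * x + d₂ * y = d₁ * x' + d₂ * y' := by
  induction x using Nat.strong_induction_on with
  | _ x ih =>
    intro hx y hy
    by_cases h : ∃ z ∈ SemOf k₁ g₁, x = z + d₂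
    · obtain ⟨z, hz, rfl⟩ := h
      obtain ⟨x', hx', y', hy', h⟩ := ih z (by omega) hz (y + d₁) (SemOf.add_mem hy hd₁)
      exact ⟨x', hx', y', hy', by rw [← h]; ring⟩
    · exact ⟨x, ⟨hx, h⟩, y, hy, rfl⟩

theorem apery_le_of_decomposition_eq {k : ℕ} {g : Fin k → ℕ} {d₁ d₂ x x' y y' : ℕ}
    (hd₂ : d₂ ∈ SemOf k g) (hcop : Nat.gcd d₁ d₂ = 1)
    (hx : ¬ ∃ y ∈ SemOf k g, x = y + d₂) (hx' : x' ∈ SemOf k g)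
    (h : d₁ * x + d₂ * y = d₁ * x' + d₂ * y') : x ≤ x' := by
  by_contra! hlt
  obtain ⟨c, rfl⟩ := Nat.exists_eq_add_of_lt hlt
  have hdvd : d₂ ∣ d₁ * (c + 1) := by
    refine (Nat.dvd_add_left (Dvd.intro y rfl)).1 (?_ : d₂ ∣ d₁ * (c + 1) + d₂ * y)
    exact ⟨y', by linarith⟩
  obtain ⟨n, hn⟩ := (Nat.Coprime.symm hcop).dvd_of_dvd_mul_left hdvd
  cases n with
  | zero => simp at hn
  | succ n =>
    exact hx ⟨x' + n * d₂, SemOf.add_mul_mem hx' hd₂ n, by rw [add_assoc x', hn]; ring⟩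

theorem ite_mul_add_mul_ite (P Q : Prop) [Decidable P] [Decidable Q] (a b : ℤ) :
    (if P then a else 0) * (if Q then 1 else 0) + (if P then 1 else 0) * (if Q then b else 0) =
      if P ∧ Q then a + b else 0 := by
  by_cases hP : P <;> by_cases hQ : Q <;> simp [hP, hQ]

/-- For an `m`-harmonic gluing `S = d₁S₁ + d₂S₂`,
`Σ_{n ∈ S} m_S(n) tⁿ = (Σ_{n ∈ Ap(S₁;d₂)} m_{S₁}(n) t^{d₁n})(Σ_{n ∈ S₂} t^{d₂n})
  + (Σ_{n ∈ Ap(S₁;d₂)} t^{d₁n})(Σ_{n ∈ S₂} m_{S₂}(n) t^{d₂n})` in `ℤ[[t]]`. -/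
theorem stmt12 (k₁ k₂ : ℕ) (hk₁ : 0 < k₁) (hk₂ : 0 < k₂)
    (g₁ : Fin k₁ → ℕ) (g₂ : Fin k₂ → ℕ)
    (hg₁pos : ∀ i, 0 < g₁ i) (hg₂pos : ∀ j, 0 < g₂ j)
    (hg₁gcd : Finset.univ.gcd g₁ = 1) (hg₂gcd : Finset.univ.gcd g₂ = 1)
    (d₁ d₂ : ℕ) (hd₁pos : 0 < d₁) (hd₂pos : 0 < d₂)
    (hd₁ : d₁ ∈ SemOf k₂ g₂) (hd₂ : d₂ ∈ SemOf k₁ g₁)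
    (hcop : Nat.gcd d₁ d₂ = 1)
    -- notation: the two semigroups, the gluing, the Apéry set, and the length functions
    (S₁ S₂ S Ap₁ : Set ℕ) (μ μ₁ μ₂ : ℕ → ℕ)
    (hS₁ : S₁ = SemOf k₁ g₁) (hS₂ : S₂ = SemOf k₂ g₂)
    (hS : S = {m | ∃ x ∈ S₁, ∃ y ∈ S₂, m = d₁ * x + d₂ * y})
    (hAp₁ : Ap₁ = {x ∈ S₁ | ¬ ∃ y ∈ S₁, x = y + d₂})
    (hμ : ∀ m, μ m = sInf (LenGlue k₁ k₂ g₁ g₂ d₁ d₂ m))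
    (hμ₁ : ∀ m, μ₁ m = sInf (LenOf k₁ g₁ m))
    (hμ₂ : ∀ m, μ₂ m = sInf (LenOf k₂ g₂ m))
    -- the `m`-harmonic gluing hypothesis
    (hharm : ∀ m ∈ S, ∀ n' ∈ Ap₁, ∀ n'' ∈ S₂,
      m = d₁ * n' + d₂ * n'' → μ m = μ₁ n' + μ₂ n'') :
    PowerSeries.mk (fun m : ℕ => if m ∈ S then (μ m : ℤ) else 0) =
      PowerSeries.mk (fun m : ℕ =>
          if d₁ ∣ m ∧ m / d₁ ∈ Ap₁ then (μ₁ (m / d₁) : ℤ) else 0) *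
        PowerSeries.mk (fun m : ℕ => if d₂ ∣ m ∧ m / d₂ ∈ S₂ then (1 : ℤ) else 0) +
      PowerSeries.mk (fun m : ℕ => if d₁ ∣ m ∧ m / d₁ ∈ Ap₁ then (1 : ℤ) else 0) *
        PowerSeries.mk (fun m : ℕ =>
          if d₂ ∣ m ∧ m / d₂ ∈ S₂ then (μ₂ (m / d₂) : ℤ) else 0) := by
  subst hS₁ hS₂ hAp₁
  ext m
  simp only [map_add, PowerSeries.coeff_mul, PowerSeries.coeff_mk, ← Finset.sum_add_distrib,
    ite_mul_add_mul_ite]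
  by_cases hm : m ∈ S
  · obtain ⟨x, hx, y, hy, hxy⟩ : ∃ x ∈ SemOf k₁ g₁, ∃ y ∈ SemOf k₂ g₂, m = d₁ * x + d₂ * y := by
      rwa [hS] at hm
    obtain ⟨x', hx', y', hy', h⟩ := exists_apery_decomposition hd₂pos hd₁ x hx y hy
    have hm' : m = d₁ * x' + d₂ * y' := hxy.trans h
    rw [if_pos hm, hharm m hm x' hx' y' hy' hm',
      Finset.sum_eq_single (d₁ * x', d₂ * y')]
    · dsimp only
      rw [Nat.mul_div_cancel_left _ hd₁pos, Nat.mul_div_cancel_left _ hd₂pos,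
        if_pos ⟨⟨Dvd.intro _ rfl, hx'⟩, Dvd.intro _ rfl, hy'⟩]
      push_cast
      rfl
    · rintro ⟨p, q⟩ hpq hne
      rw [if_neg]
      rintro ⟨⟨⟨u, rfl⟩, hu⟩, ⟨v, rfl⟩, -⟩
      dsimp only at hu hpq hne
      rw [Nat.mul_div_cancel_left _ hd₁pos] at hu
      have huv : d₁ * u + d₂ * v = d₁ * x' + d₂ * y' :=
        (Finset.HasAntidiagonal.mem_antidiagonal.1 hpq).trans hm'
      obtain rfl : u = x' := le_antisymm
        (apery_le_of_decomposition_eq hd₂ hcop hu.2 hx'.1 huv)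
        (apery_le_of_decomposition_eq hd₂ hcop hx'.2 hu.1 huv.symm)
      exact hne (by rw [Nat.add_left_cancel huv])
    · exact fun hp => absurd (Finset.HasAntidiagonal.mem_antidiagonal.2 hm'.symm) hp
  · rw [if_neg hm, eq_comm]
    refine Finset.sum_eq_zero ?_
    rintro ⟨p, q⟩ hpq
    rw [if_neg]
    rintro ⟨⟨⟨u, rfl⟩, hu⟩, ⟨v, rfl⟩, hv⟩
    dsimp only at hu hv hpq
    rw [Nat.mul_div_cancel_left _ hd₁pos] at hu
    rw [Nat.mul_div_cancel_left _ hd₂pos] at hv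
    refine hm ?_
    rw [hS]
    exact ⟨u, hu.1, v, hv, (Finset.HasAntidiagonal.mem_antidiagonal.1 hpq).symm⟩
end

section
/- In ℤ[[t]] one has the identity ∏_{i=1}^k (1 − t^{n_i}) · Σ_{n ∈ S} t^n = Σ_{m ≥ 0} χ(Δ_m) t^m, where χ(Δ_m) = Σ_{F ⊆ {1,…,k}, m − n_F ∈ S} (−1)^{|F|}; moreover χ(Δ_m) = 0 for all sufficiently large m, so the right-hand side is a polynomial. -/
open scoped Classical

/-- The numerical semigroup generated by `n 0, …, n (k-1)`, viewed as a subset of `ℤ`. -/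
def SemigroupSet (k : ℕ) (n : Fin k → ℕ) : Set ℤ :=
  {z | ∃ a : Fin k → ℕ, z = ∑ i, (a i : ℤ) * (n i : ℤ)}

/-- The Euler characteristic `χ(Δ_z) = Σ_{F ⊆ [k], z - n_F ∈ S} (-1)^{|F|}`. -/
noncomputable def eulerChar (k : ℕ) (n : Fin k → ℕ) (z : ℤ) : ℤ :=
  ∑ F : Finset (Fin k),
    if (z - ∑ i ∈ F, (n i : ℤ)) ∈ SemigroupSet k n then (-1 : ℤ) ^ F.card else 0

theorem nonneg_of_mem_semigroupSet {k : ℕ} {n : Fin k → ℕ} {z : ℤ}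
    (hz : z ∈ SemigroupSet k n) : 0 ≤ z := by
  obtain ⟨a, rfl⟩ := hz
  positivity

theorem natCast_mem_semigroupSet_of_mem_closure {k : ℕ} {n : Fin k → ℕ} {m : ℕ}
    (hm : m ∈ AddSubmonoid.closure (Set.range n)) : (m : ℤ) ∈ SemigroupSet k n := by
  rw [← Submodule.span_nat_eq_addSubmonoidClosure, Submodule.mem_toAddSubmonoid,
    Submodule.mem_span_range_iff_exists_fun] at hm
  obtain ⟨a, rfl⟩ := hm
  exact ⟨a, by simp⟩

/-- A numerical semigroup with coprime generators contains all sufficiently large integers. -/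
theorem exists_forall_ge_mem_semigroupSet {k : ℕ} {n : Fin k → ℕ}
    (hgcd : Finset.univ.gcd n = 1) : ∃ c : ℕ, ∀ z : ℤ, c ≤ z → z ∈ SemigroupSet k n := by
  obtain ⟨c, hc⟩ := Nat.exists_mem_closure_of_ge (Set.range n)
  have hset : Nat.setGcd (Set.range n) = 1 :=
    Nat.dvd_one.mp <| hgcd ▸ Finset.dvd_gcd fun i _ => Nat.setGcd_dvd_of_mem ⟨i, rfl⟩
  refine ⟨c, fun z hz => ?_⟩
  lift z to ℕ using by lia
  exact natCast_mem_semigroupSet_of_mem_closure (hc z (by exact_mod_cast hz) (by simp [hset]))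

theorem prod_one_sub_X_pow {k : ℕ} (n : Fin k → ℕ) :
    ∏ i, (1 - (PowerSeries.X : PowerSeries ℤ) ^ n i) =
      ∑ F : Finset (Fin k), (-1) ^ F.card * PowerSeries.X ^ ∑ i ∈ F, n i := by
  simp_rw [sub_eq_add_neg, Finset.prod_one_add, Finset.powerset_univ, Finset.prod_neg,
    Finset.prod_pow_eq_pow_sum]

theorem prod_one_sub_X_pow_mul_mk_indicator (k : ℕ) (n : Fin k → ℕ) :
    (∏ i, (1 - (PowerSeries.X : PowerSeries ℤ) ^ n i)) *
        PowerSeries.mk (fun m : ℕ => if (m : ℤ) ∈ SemigroupSet k n then (1 : ℤ) else 0) =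
      PowerSeries.mk (fun m : ℕ => eulerChar k n (m : ℤ)) := by
  ext m
  rw [prod_one_sub_X_pow, Finset.sum_mul, map_sum, PowerSeries.coeff_mk, eulerChar]
  refine Finset.sum_congr rfl fun F _ => ?_
  rw [show ((-1) ^ F.card : PowerSeries ℤ) = PowerSeries.C ((-1) ^ F.card) by simp, mul_assoc,
    PowerSeries.coeff_C_mul, PowerSeries.coeff_X_pow_mul', ← Nat.cast_sum]
  split_ifs with hle hmem hmem
  · rw [PowerSeries.coeff_mk, Nat.cast_sub hle, if_pos hmem, mul_one]
  · rw [PowerSeries.coeff_mk, Nat.cast_sub hle, if_neg hmem, mul_zero]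
  · exact absurd (nonneg_of_mem_semigroupSet hmem) (by lia)
  · simp

theorem exists_forall_gt_eulerChar_eq_zero {k : ℕ} (hk : 0 < k) {n : Fin k → ℕ}
    (hgcd : Finset.univ.gcd n = 1) : ∃ N : ℕ, ∀ m : ℕ, N < m → eulerChar k n (m : ℤ) = 0 := by
  obtain ⟨c, hc⟩ := exists_forall_ge_mem_semigroupSet hgcd
  refine ⟨c + ∑ i, n i, fun m hm => ?_⟩
  have hmem (F : Finset (Fin k)) : (m : ℤ) - ∑ i ∈ F, (n i : ℤ) ∈ SemigroupSet k n := by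
    have hF : ∑ i ∈ F, n i ≤ ∑ i, n i := Finset.sum_le_sum_of_subset F.subset_univ
    rw [← Nat.cast_sum]
    exact hc _ (by lia)
  have : Nonempty (Fin k) := ⟨⟨0, hk⟩⟩
  simp_rw [eulerChar, if_pos (hmem _), ← Finset.powerset_univ]
  exact Finset.sum_powerset_neg_one_pow_card_of_nonempty Finset.univ_nonempty

/-- In `ℤ[[t]]`,
`∏_{i=1}^k (1 - t^{n_i}) · Σ_{n ∈ S} tⁿ = Σ_{m ≥ 0} χ(Δ_m) tᵐ`; moreover
`χ(Δ_m) = 0` for all sufficiently large `m`, so the right-hand side is a polynomial. -/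
theorem stmt18 (k : ℕ) (hk : 0 < k) (n : Fin k → ℕ)
    (hpos : ∀ i, 0 < n i) (hmono : StrictMono n)
    (hgcd : Finset.univ.gcd n = 1) :
    (∏ i, (1 - (PowerSeries.X : PowerSeries ℤ) ^ (n i))) *
        PowerSeries.mk (fun m : ℕ => if (m : ℤ) ∈ SemigroupSet k n then (1 : ℤ) else 0) =
      PowerSeries.mk (fun m : ℕ => eulerChar k n (m : ℤ)) ∧
    ∃ N : ℕ, ∀ m : ℕ, N < m → eulerChar k n (m : ℤ) = 0 :=
  ⟨prod_one_sub_X_pow_mul_mk_indicator k n, exists_forall_gt_eulerChar_eq_zero hk hgcd⟩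
end
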